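/- Let (M,Q) be a nondegenerate finite quadratic module and let U ≤ M be an isotropic self-dual subgroup (Q vanishes on U and U^⊥ = U). Then the indicator function 1_U of U (the function I_U = Σ_{x∈U} ⟨x⟩) lies in Inv(M): T_M 1_U = 1_U and S_M 1_U = 1_U. -/

import Mathlib

noncomputable section

/-- `ℚ/ℤ` as the additive circle of circumference 1. -/
abbrev QZ : Type := AddCircle (1 : ℚ)

lemma expPeriodic : Function.Periodic
    (fun q : ℚ => Complex.exp (2 * Real.pi * Complex.I * (q : ℂ))) 1 := by
  intro x
  push_cast
  rw [mul_add, Complex.exp_add, mul_one, Complex.exp_two_pi_mul_I, mul_one]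

/-- The standard character `e : ℚ/ℤ → ℂ`, `e(t) = exp(2πi t)`. -/
def ee : QZ → ℂ := expPeriodic.lift

variable {M : Type} [AddCommGroup M]

/-- The bilinear form associated to a quadratic form `Q : M → ℚ/ℤ`. -/
def Bf (Q : M → QZ) (x y : M) : QZ := Q (x + y) - Q x - Q y

/-- The Gauss sum `σ(M) = |M|^{-1/2} ∑_{x ∈ M} e(-Q(x))`. -/
def gaussSigma (Q : M → QZ) : ℂ :=
  ((Real.sqrt (Nat.card M) : ℂ))⁻¹ * ∑ᶠ x : M, ee (-(Q x))

/-- The operator `T_M` of the Weil representation: `(T_M λ)(x) = e(Q(x))·λ(x)`. -/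
def Tweil (Q : M → QZ) (lam : M → ℂ) : M → ℂ := fun x => ee (Q x) * lam x

/-- The operator `S_M` of the Weil representation:
`(S_M λ)(y) = σ(M)·|M|^{-1/2}·∑_{x∈M} e(-B(y,x))·λ(x)`. -/
def Sweil (Q : M → QZ) (lam : M → ℂ) : M → ℂ := fun y =>
  gaussSigma Q * ((Real.sqrt (Nat.card M) : ℂ))⁻¹ *
    ∑ᶠ x : M, ee (-(Bf Q y x)) * lam x

/-- The `p`-primary component of an abelian group, as a subgroup. -/
def primaryComp (M : Type) [AddCommGroup M] (p : ℕ) : AddSubgroup M where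
  carrier := {x | ∃ k : ℕ, (p ^ k : ℕ) • x = 0}
  zero_mem' := ⟨0, smul_zero _⟩
  add_mem' := by
    rintro a b ⟨k, hk⟩ ⟨l, hl⟩
    refine ⟨k + l, ?_⟩
    have ha : (p ^ (k + l) : ℕ) • a = 0 := by
      rw [pow_add, mul_comm, mul_smul, hk, smul_zero]
    have hb : (p ^ (k + l) : ℕ) • b = 0 := by
      rw [pow_add, mul_smul, hl, smul_zero]
    rw [smul_add, ha, hb, add_zero]
  neg_mem' := by
    rintro a ⟨k, hk⟩
    exact ⟨k, by rw [smul_neg, hk, neg_zero]⟩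

end

theorem ee_coe (q : ℚ) : ee (q : QZ) = Complex.exp (2 * Real.pi * Complex.I * (q : ℂ)) :=
  expPeriodic.lift_coe q

theorem ee_add (s t : QZ) : ee (s + t) = ee s * ee t := by
  induction s using QuotientAddGroup.induction_on with | _ a =>
  induction t using QuotientAddGroup.induction_on with | _ b =>
  have h := ee_coe (a + b)
  rw [AddCircle.coe_add] at h
  refine h.trans ?_
  refine Eq.trans ?_ (congrArg₂ (· * ·) (ee_coe a) (ee_coe b)).symm
  rw [← Complex.exp_add]
  push_cast
  ring_nf

theorem ee_zero : ee 0 = 1 := by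
  have h := ee_coe 0
  rw [AddCircle.coe_zero] at h
  simpa using h

theorem ee_eq_one (t : QZ) (h : ee t = 1) : t = 0 := by
  induction t using QuotientAddGroup.induction_on with | _ a =>
  have h2 := (ee_coe a).symm.trans h
  rw [Complex.exp_eq_one_iff] at h2
  obtain ⟨n, hn⟩ := h2
  have h3 : (a : ℂ) = n := by
    have : (2 * Real.pi * Complex.I : ℂ) ≠ 0 := Complex.two_pi_I_ne_zero
    apply mul_left_cancel₀ this
    rw [hn]; ring
  have h4 : a = n := by exact_mod_cast h3
  refine (AddCircle.coe_eq_zero_iff (1 : ℚ)).2 ⟨n, ?_⟩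
  simp [h4]

open Classical in
theorem sum_ee {G : Type} [AddCommGroup G] [Fintype G] (b : G → QZ)
    (hb : ∀ x y, b (x + y) = b x + b y) :
    ∑ x, ee (-(b x)) = if ∀ x, b x = 0 then (Fintype.card G : ℂ) else 0 := by
  split_ifs with h
  · simp [h, ee_zero]
  · push Not at h
    obtain ⟨a, ha⟩ := h
    have h1 : ∑ x, ee (-(b x)) = ee (-(b a)) * ∑ x, ee (-(b x)) := by
      rw [Finset.mul_sum, ← Equiv.sum_comp (Equiv.addLeft a)]
      refine Finset.sum_congr rfl fun x _ => ?_
      rw [← ee_add]; congr 1; simp [hb]; abel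
    by_contra h0
    have : ee (-(b a)) = 1 := by
      apply mul_right_cancel₀ h0
      rw [← h1, one_mul]
    exact ha (neg_eq_zero.1 (ee_eq_one _ this))

/-- for an isotropic self-dual subgroup `U` of a nondegenerate finite
quadratic module `(M,Q)`, the indicator function `1_U` lies in `Inv(M)`:
`T_M 1_U = 1_U` and `S_M 1_U = 1_U`. -/
theorem indicator_invariant {M : Type} [AddCommGroup M] [Finite M] (Q : M → QZ)
    (hquad : ∀ (n : ℤ) (x : M), Q (n • x) = (n ^ 2 : ℤ) • Q x)
    (hbil : ∀ x x' y : M, Bf Q (x + x') y = Bf Q x y + Bf Q x' y)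
    (hnd : ∀ x : M, (∀ y : M, Bf Q x y = 0) → x = 0)
    (U : AddSubgroup M)
    (hiso : ∀ x ∈ U, Q x = 0)
    (hsd : ∀ y : M, y ∈ U ↔ ∀ x ∈ U, Bf Q x y = 0) :
    Tweil Q ((U : Set M).indicator 1) = (U : Set M).indicator 1 ∧
    Sweil Q ((U : Set M).indicator 1) = (U : Set M).indicator 1 := by
  classical
  have := Fintype.ofFinite M
  have hsymm : ∀ x y, Bf Q x y = Bf Q y x := fun x y => by
    unfold Bf; rw [add_comm x y]; abel
  have hbil2 : ∀ x y y', Bf Q x (y + y') = Bf Q x y + Bf Q x y' := fun x y y' => by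
    rw [hsymm, hbil, hsymm y, hsymm y']
  have hU : ∀ y, ∑ u : U, ee (-(Bf Q y u)) = if y ∈ U then (Fintype.card U : ℂ) else 0 := by
    intro y
    rw [sum_ee (fun u : U => Bf Q y u) (fun u v => by simp [hbil2])]
    refine if_congr ?_ rfl rfl
    rw [hsd y]
    simp only [Subtype.forall]
    exact forall₂_congr fun x _ => by rw [hsymm]
  have hsubU : ∀ f : M → ℂ, ∑ x, (if x ∈ U then f x else 0) = ∑ u : U, f u := by
    intro f
    rw [← Finset.sum_filter]
    exact Finset.sum_subtype _ (by simp) _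
  have hcU : (Fintype.card U : ℂ) ≠ 0 := by exact_mod_cast Fintype.card_ne_zero
  have hcM : (Fintype.card U : ℂ) * Fintype.card U = Fintype.card M := by
    have h1 : ∑ x : M, ∑ u : U, ee (-(Bf Q x u)) = (Fintype.card U : ℂ) * Fintype.card U := by
      simp_rw [hU]
      rw [hsubU (fun _ => (Fintype.card U : ℂ))]
      simp
    rw [← h1, Finset.sum_comm]
    have h2 : ∀ u : U, ∑ x : M, ee (-(Bf Q x u)) = if u = 0 then (Fintype.card M : ℂ) else 0 := by
      intro u
      rw [sum_ee (fun x : M => Bf Q x u) (fun x y => hbil x y u)]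
      refine if_congr ⟨fun h => ?_, fun h x => ?_⟩ rfl rfl
      · exact Subtype.ext (hnd u fun y => by rw [hsymm]; exact h y)
      · have := hbil2 x 0 0
        subst h
        simpa using this
    simp_rw [h2]
    simp
  have hg : ∑ x : M, ee (-(Q x)) = Fintype.card U := by
    apply mul_left_cancel₀ hcU
    have h1 : ∀ u : U, ∑ x : M, ee (-(Q x)) = ∑ x : M, ee (-(Q x)) * ee (-(Bf Q x u)) := by
      intro u
      rw [← Equiv.sum_comp (Equiv.addRight (u : M))]
      refine Finset.sum_congr rfl fun x _ => ?_
      rw [← ee_add]; congr 1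
      simp [Bf, hiso u u.2]
      abel
    have h2 : (Fintype.card U : ℂ) * ∑ x : M, ee (-(Q x))
        = ∑ u : U, ∑ x : M, ee (-(Q x)) * ee (-(Bf Q x u)) := by
      rw [← Finset.sum_congr rfl (fun u _ => h1 u)]
      simp
    rw [h2, Finset.sum_comm]
    simp_rw [← Finset.mul_sum, hU, mul_ite, mul_zero]
    rw [hsubU (fun x => ee (-(Q x)) * Fintype.card U)]
    have h3 : ∀ u : U, ee (-(Q u)) = 1 := fun u => by rw [hiso u u.2, neg_zero, ee_zero]
    simp [h3]
  constructor
  · funext x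
    by_cases hx : x ∈ U
    · simp [Tweil, hx, hiso x hx, ee_zero]
    · simp [Tweil, hx]
  · funext y
    have h1 : ∑ x : M, ee (-(Bf Q y x)) * (U : Set M).indicator 1 x
        = if y ∈ U then (Fintype.card U : ℂ) else 0 := by
      rw [← hU y, ← hsubU (fun x => ee (-(Bf Q y x)))]
      refine Finset.sum_congr rfl fun x _ => ?_
      simp [Set.indicator_apply]
    have hs : ((Real.sqrt (Nat.card M) : ℂ)) * (Real.sqrt (Nat.card M) : ℂ) = Fintype.card M := by
      rw [← Complex.ofReal_mul, Real.mul_self_sqrt (Nat.cast_nonneg _), Nat.card_eq_fintype_card]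
      simp
    have hM0 : (Fintype.card M : ℂ) ≠ 0 := by exact_mod_cast Fintype.card_ne_zero
    have hs0 : (Real.sqrt (Nat.card M) : ℂ) ≠ 0 := fun h => by
      rw [h, zero_mul] at hs; exact hM0 hs.symm
    rw [Sweil, gaussSigma, finsum_eq_sum_of_fintype, finsum_eq_sum_of_fintype, h1, hg]
    by_cases hy : y ∈ U
    · simp only [hy, if_true, Set.indicator_apply, SetLike.mem_coe, Pi.one_apply]
      have := hcM.trans hs.symm
      field_simp
      rw [pow_two, pow_two]
      exact this
    · simp [hy]
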